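/- arXiv:math/0603336 — 2 statements merged into one kernel-verified Lean document; each statement's English description precedes it below -/
import Mathlib

section
/- Let f_i : U_i → V_i and g_i : W_i → V_i (i = 1,2) be chain maps of chain complexes of ℚ-vector spaces, and let t_U : U_1 → U_2, t_V : V_1 → V_2, t_W : W_1 → W_2 be chain maps with t_V ∘ f_1 = f_2 ∘ t_U and t_V ∘ g_1 = g_2 ∘ t_W. If t_U, t_V and t_W are all quasi-isomorphisms, then the induced chain map of path complexes 𝒫(f_1, g_1) → 𝒫(f_2, g_2), given degreewise by (u, v, w) ↦ (t_U u, t_V v, t_W w), is a quasi-isomorphism. (This is the homotopy invariance of the path-complex model for homotopy pullbacks of rational chain complexes.) -/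
set_option autoImplicit false

/-- A `ℤ`-indexed graded `ℚ`-vector space equipped with a degree `-1` linear map
(the underlying data of a chain complex). -/
structure PreDG where
  V : ℤ → Type
  [grp : ∀ n, AddCommGroup (V n)]
  [mod : ∀ n, Module ℚ (V n)]
  d : ∀ n : ℤ, V n →ₗ[ℚ] V (n - 1)

attribute [instance] PreDG.grp PreDG.mod

/-- A chain complex of `ℚ`-vector spaces: the differential squares to zero. -/
structure DG extends PreDG where
  dd : ∀ (n : ℤ) (x : V n), d (n - 1) (d n x) = 0

namespace PreDG

/-- Transport along an equality of degrees. -/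
def castV (A : PreDG) : ∀ {m n : ℤ}, m = n → (A.V m →ₗ[ℚ] A.V n)
  | _, _, rfl => LinearMap.id

/-- A chain map: a family of degree-0 linear maps commuting with the differentials. -/
structure Hom (A B : PreDG) where
  f : ∀ n : ℤ, A.V n →ₗ[ℚ] B.V n
  comm : ∀ (n : ℤ) (x : A.V n), f (n - 1) (A.d n x) = B.d n (f n x)

theorem Hom.cast_comm {A B : PreDG} (φ : Hom A B) {m n : ℤ} (h : m = n) (x : A.V m) :
    φ.f n (A.castV h x) = B.castV h (φ.f m x) := by subst h; rfl

/-- The cycles in degree `n`. -/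
def cycles (A : PreDG) (n : ℤ) : Submodule ℚ (A.V n) :=
  LinearMap.ker (A.d n)

/-- The boundaries in degree `n`. -/
def boundaries (A : PreDG) (n : ℤ) : Submodule ℚ (A.V n) :=
  LinearMap.range ((A.castV (show n + 1 - 1 = n by omega)).comp (A.d (n + 1)))

/-- The homology in degree `n`: cycles modulo boundaries. -/
abbrev homology (A : PreDG) (n : ℤ) :=
  A.cycles n ⧸ ((A.boundaries n).comap (A.cycles n).subtype)

/-- A chain map sends cycles to cycles. -/
def Hom.cyclesMap {A B : PreDG} (φ : Hom A B) (n : ℤ) :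
    A.cycles n →ₗ[ℚ] B.cycles n :=
  (φ.f n).restrict (fun x hx => by
    have hx' : A.d n x = 0 := hx
    show B.d n (φ.f n x) = 0
    rw [← φ.comm n x, hx', map_zero])

/-- The map induced on homology by a chain map. -/
def Hom.homologyMap {A B : PreDG} (φ : Hom A B) (n : ℤ) :
    A.homology n →ₗ[ℚ] B.homology n :=
  Submodule.mapQ _ _ (φ.cyclesMap n) (by
    rintro ⟨x, hxc⟩ hx
    simp only [Submodule.mem_comap, Submodule.subtype_apply, boundaries,
      LinearMap.mem_range, LinearMap.coe_comp, Function.comp_apply] at hx ⊢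
    obtain ⟨y, hy⟩ := hx
    refine ⟨φ.f (n + 1) y, ?_⟩
    have hcoe : ((φ.cyclesMap n ⟨x, hxc⟩ : B.cycles n) : B.V n) = φ.f n x := rfl
    rw [hcoe, ← φ.comm (n + 1) y, ← φ.cast_comm, hy])

/-- A chain map is a quasi-isomorphism if it induces an isomorphism on homology in every
degree. -/
def Hom.QuasiIso {A B : PreDG} (φ : Hom A B) : Prop :=
  ∀ n : ℤ, Function.Bijective (φ.homologyMap n)

/-- The `n`-th term of the path complex `𝒫(f,g)` of a cospan `f : A → B ← C : g`:
`A_n × B_{n+1} × C_n`. -/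
abbrev pathV (A B C : PreDG) (n : ℤ) : Type := A.V n × B.V (n + 1) × C.V n

/-- The differential of the path complex `𝒫(f,g)`:
`d (u, v, w) = (d_A u, f u + g w - d_B v, d_C w)`. -/
def pathD (A B C : PreDG) (f : ∀ n : ℤ, A.V n →ₗ[ℚ] B.V n)
    (g : ∀ n : ℤ, C.V n →ₗ[ℚ] B.V n) (n : ℤ) :
    pathV A B C n →ₗ[ℚ] pathV A B C (n - 1) :=
  LinearMap.prod
    ((A.d n).comp (LinearMap.fst ℚ (A.V n) (B.V (n + 1) × C.V n)))
    (LinearMap.prod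
      ((B.castV (show n = n - 1 + 1 by omega)).comp
          ((f n).comp (LinearMap.fst ℚ (A.V n) (B.V (n + 1) × C.V n))
            + (g n).comp ((LinearMap.snd ℚ (B.V (n + 1)) (C.V n)).comp
                (LinearMap.snd ℚ (A.V n) (B.V (n + 1) × C.V n))))
        - (B.castV (show n + 1 - 1 = n - 1 + 1 by omega)).comp
            ((B.d (n + 1)).comp ((LinearMap.fst ℚ (B.V (n + 1)) (C.V n)).comp
                (LinearMap.snd ℚ (A.V n) (B.V (n + 1) × C.V n)))))
      ((C.d n).comp ((LinearMap.snd ℚ (B.V (n + 1)) (C.V n)).comp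
          (LinearMap.snd ℚ (A.V n) (B.V (n + 1) × C.V n)))))

/-- The path-complex differential is given by the formula
`d (u, v, w) = (d_A u, f u + g w - d_B v, d_C w)` (up to transport of degrees). -/
theorem pathD_apply (A B C : PreDG) (f : ∀ n : ℤ, A.V n →ₗ[ℚ] B.V n)
    (g : ∀ n : ℤ, C.V n →ₗ[ℚ] B.V n) (n : ℤ) (u : A.V n) (v : B.V (n + 1)) (w : C.V n) :
    pathD A B C f g n (u, v, w)
      = (A.d n u,
         B.castV (show n = n - 1 + 1 by omega) (f n u + g n w)
           - B.castV (show n + 1 - 1 = n - 1 + 1 by omega) (B.d (n + 1) v),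
         C.d n w) := rfl

/-- The path complex `𝒫(f,g)` (as a graded vector space with degree `-1` map). -/
def pathPre (A B C : PreDG) (f : ∀ n : ℤ, A.V n →ₗ[ℚ] B.V n)
    (g : ∀ n : ℤ, C.V n →ₗ[ℚ] B.V n) : PreDG where
  V := pathV A B C
  grp := fun _ => inferInstance
  mod := fun _ => inferInstance
  d := pathD A B C f g

end PreDG

open PreDG

namespace PreDG

/-- The differential `V (n+1) → V n`. -/
def bd (A : PreDG) (n : ℤ) : A.V (n + 1) →ₗ[ℚ] A.V n :=
  (A.castV (show n + 1 - 1 = n by omega)).comp (A.d (n + 1))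

theorem castV_inj (A : PreDG) {m n : ℤ} (h : m = n) (x : A.V m) :
    A.castV h x = 0 ↔ x = 0 := by subst h; rfl

theorem castV_castV (A : PreDG) {m n k : ℤ} (h : m = n) (h' : n = k) (x : A.V m) :
    A.castV h' (A.castV h x) = A.castV (h.trans h') x := by subst h; subst h'; rfl

theorem castV_self (A : PreDG) {m : ℤ} (h : m = m) (x : A.V m) :
    A.castV h x = x := rfl

theorem bd_eq_zero (A : PreDG) (n : ℤ) (x : A.V (n + 1)) :
    A.bd n x = 0 ↔ A.d (n + 1) x = 0 := A.castV_inj _ _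

theorem Hom.bd_comm {A B : PreDG} (φ : Hom A B) (n : ℤ) (x : A.V (n + 1)) :
    φ.f n (A.bd n x) = B.bd n (φ.f (n + 1) x) := by
  simp only [bd, LinearMap.comp_apply, φ.cast_comm, φ.comm]

/-- Acyclicity of the mapping cone. -/
def Hom.ConeExact {A B : PreDG} (φ : Hom A B) : Prop :=
  ∀ (n : ℤ) (a : A.V n) (b : B.V (n + 1)), A.d n a = 0 → φ.f n a = B.bd n b →
    ∃ (a' : A.V (n + 1)) (b' : B.V (n + 1 + 1)),
      A.bd n a' = a ∧ φ.f (n + 1) a' = b + B.bd (n + 1) b'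

theorem Hom.inj_iff {A B : PreDG} (φ : Hom A B) (n : ℤ) :
    Function.Injective (φ.homologyMap n) ↔
      ∀ (a : A.V n) (b : B.V (n + 1)), A.d n a = 0 → φ.f n a = B.bd n b →
        ∃ a' : A.V (n + 1), A.bd n a' = a := by
  rw [injective_iff_map_eq_zero]
  constructor
  · intro h a b ha hab
    have h1 := h (Submodule.Quotient.mk ⟨a, ha⟩) (by
      refine (Submodule.Quotient.mk_eq_zero _).2 ?_
      exact ⟨b, hab.symm⟩)
    exact (Submodule.Quotient.mk_eq_zero _).1 h1
  · intro h x hx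
    obtain ⟨⟨a, ha⟩, rfl⟩ := Submodule.Quotient.mk_surjective _ x
    obtain ⟨b, hb⟩ := (Submodule.Quotient.mk_eq_zero _).1 hx
    exact (Submodule.Quotient.mk_eq_zero _).2 (h a b ha hb.symm)

theorem Hom.surj_iff {A B : PreDG} (φ : Hom A B) (n : ℤ) :
    Function.Surjective (φ.homologyMap n) ↔
      ∀ (b : B.V n), B.d n b = 0 →
        ∃ (a : A.V n) (b' : B.V (n + 1)), A.d n a = 0 ∧ φ.f n a = b + B.bd n b' := by
  constructor
  · intro h b hb
    obtain ⟨x, hx⟩ := h (Submodule.Quotient.mk ⟨b, hb⟩)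
    obtain ⟨⟨a, ha⟩, rfl⟩ := Submodule.Quotient.mk_surjective _ x
    obtain ⟨b', hb'⟩ := (Submodule.Quotient.eq _).1 hx
    have hb'' : B.bd n b' = φ.f n a - b := hb'
    exact ⟨a, b', ha, by rw [hb'']; abel⟩
  · intro h y
    obtain ⟨⟨b, hb⟩, rfl⟩ := Submodule.Quotient.mk_surjective _ y
    obtain ⟨a, b', ha, h'⟩ := h b hb
    refine ⟨Submodule.Quotient.mk ⟨a, ha⟩, (Submodule.Quotient.eq _).2 ⟨b', ?_⟩⟩
    show B.bd n b' = φ.f n a - b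
    rw [h']; abel

theorem Hom.QuasiIso.coneExact {A B : PreDG} {φ : Hom A B} (h : φ.QuasiIso) :
    φ.ConeExact := by
  intro n a b ha hab
  obtain ⟨a₀, ha₀⟩ := (φ.inj_iff n).1 (h n).1 a b ha hab
  obtain ⟨z, c, hz, hc⟩ := (φ.surj_iff (n + 1)).1 (h (n + 1)).2 (φ.f (n + 1) a₀ - b) (by
    rw [← bd_eq_zero, map_sub, ← φ.bd_comm, ha₀, hab, sub_self])
  refine ⟨a₀ - z, -c, ?_, ?_⟩
  · rw [map_sub, (A.bd_eq_zero n z).2 hz, ha₀, sub_zero]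
  · rw [map_sub, hc, map_neg]; abel

theorem Hom.ConeExact.quasiIso {A B : PreDG} {φ : Hom A B} (h : φ.ConeExact) :
    φ.QuasiIso := by
  intro m
  refine ⟨(φ.inj_iff m).2 ?_, (φ.surj_iff m).2 ?_⟩
  · intro a b ha hab
    obtain ⟨a', -, h', -⟩ := h m a b ha hab
    exact ⟨a', h'⟩
  · obtain ⟨n, rfl⟩ : ∃ n, m = n + 1 := ⟨m - 1, by omega⟩
    intro b hb
    obtain ⟨a', b', h1, h2⟩ := h n 0 b (map_zero _) (by
      rw [map_zero, (B.bd_eq_zero n b).2 hb])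
    exact ⟨a', b', (A.bd_eq_zero n a').1 h1, h2⟩

theorem castV_path (A B C : PreDG) (f : ∀ n : ℤ, A.V n →ₗ[ℚ] B.V n)
    (g : ∀ n : ℤ, C.V n →ₗ[ℚ] B.V n) {m n : ℤ} (h : m = n) (u : A.V m)
    (v : B.V (m + 1)) (w : C.V m) :
    (pathPre A B C f g).castV h ((u, v, w) : pathV A B C m)
      = ((A.castV h u, B.castV (congrArg (· + 1) h) v, C.castV h w) : pathV A B C n) := by
  subst h; rfl

theorem bd_path (A B C : PreDG) (f : ∀ n : ℤ, A.V n →ₗ[ℚ] B.V n)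
    (g : ∀ n : ℤ, C.V n →ₗ[ℚ] B.V n) (n : ℤ) (u : A.V (n + 1))
    (v : B.V (n + 1 + 1)) (w : C.V (n + 1)) :
    (pathPre A B C f g).bd n ((u, v, w) : pathV A B C (n + 1))
      = ((A.bd n u, f (n + 1) u + g (n + 1) w - B.bd (n + 1) v, C.bd n w) :
          pathV A B C n) := by
  refine (castV_path A B C f g _ _ _ _).trans ?_
  refine Prod.ext rfl (Prod.ext ?_ rfl)
  show B.castV (show n + 1 - 1 + 1 = n + 1 by omega)
    (B.castV (show n + 1 = n + 1 - 1 + 1 by omega) (f (n + 1) u + g (n + 1) w)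
      - B.castV (show n + 1 + 1 - 1 = n + 1 - 1 + 1 by omega) (B.d (n + 1 + 1) v))
    = f (n + 1) u + g (n + 1) w - B.bd (n + 1) v
  rw [map_sub, castV_castV, castV_castV, castV_self]
  rfl

theorem d_path (A B C : PreDG) (f : ∀ n : ℤ, A.V n →ₗ[ℚ] B.V n)
    (g : ∀ n : ℤ, C.V n →ₗ[ℚ] B.V n) (n : ℤ) (u : A.V n)
    (v : B.V (n + 1)) (w : C.V n) :
    (pathPre A B C f g).d n ((u, v, w) : pathV A B C n)
      = ((A.d n u, B.castV (show n = n - 1 + 1 by omega) (f n u + g n w - B.bd n v),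
          C.d n w) : pathV A B C (n - 1)) := by
  refine (pathD_apply A B C f g n u v w).trans ?_
  rw [map_sub, bd, LinearMap.comp_apply, castV_castV]

end PreDG

/-- Homotopy invariance of the path-complex model for homotopy pullbacks:
if a map of cospans `(t_U, t_V, t_W)` consists of quasi-isomorphisms, then the induced
chain map of path complexes `𝒫(f₁,g₁) → 𝒫(f₂,g₂)`, given degreewise by
`(u, v, w) ↦ (t_U u, t_V v, t_W w)`, is a quasi-isomorphism. -/
theorem path_complex_quasiIso
    (U₁ V₁ W₁ U₂ V₂ W₂ : DG)
    (f₁ : Hom U₁.toPreDG V₁.toPreDG) (g₁ : Hom W₁.toPreDG V₁.toPreDG)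
    (f₂ : Hom U₂.toPreDG V₂.toPreDG) (g₂ : Hom W₂.toPreDG V₂.toPreDG)
    (tU : Hom U₁.toPreDG U₂.toPreDG) (tV : Hom V₁.toPreDG V₂.toPreDG)
    (tW : Hom W₁.toPreDG W₂.toPreDG)
    (hf : ∀ (n : ℤ) (x : U₁.V n), tV.f n (f₁.f n x) = f₂.f n (tU.f n x))
    (hg : ∀ (n : ℤ) (x : W₁.V n), tV.f n (g₁.f n x) = g₂.f n (tW.f n x))
    (htU : tU.QuasiIso) (htV : tV.QuasiIso) (htW : tW.QuasiIso) :
    ∃ ψ : Hom (pathPre U₁.toPreDG V₁.toPreDG W₁.toPreDG f₁.f g₁.f)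
              (pathPre U₂.toPreDG V₂.toPreDG W₂.toPreDG f₂.f g₂.f),
      (∀ (n : ℤ) (x : pathV U₁.toPreDG V₁.toPreDG W₁.toPreDG n),
          ψ.f n x = (tU.f n x.1, tV.f (n + 1) x.2.1, tW.f n x.2.2)) ∧
      ψ.QuasiIso := by
  let ψ : Hom (pathPre U₁.toPreDG V₁.toPreDG W₁.toPreDG f₁.f g₁.f)
              (pathPre U₂.toPreDG V₂.toPreDG W₂.toPreDG f₂.f g₂.f) :=
    { f := fun n => (tU.f n).prodMap ((tV.f (n + 1)).prodMap (tW.f n))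
      comm := by
        rintro n ⟨u, v, w⟩
        refine (congrArg _ (d_path _ _ _ _ _ n u v w)).trans ?_
        refine Eq.trans ?_ (d_path _ _ _ _ _ n (tU.f n u) (tV.f (n + 1) v) (tW.f n w)).symm
        refine Prod.ext (tU.comm n u) (Prod.ext ?_ (tW.comm n w))
        show tV.f (n - 1 + 1) (V₁.castV _ _) = _
        rw [tV.cast_comm, map_sub, map_add, hf, hg, tV.bd_comm] }
  refine ⟨ψ, fun _ _ => rfl, Hom.ConeExact.quasiIso ?_⟩
  rintro n ⟨u₁, v₁, w₁⟩ ⟨u₂, v₂, w₂⟩ h1 h2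
  replace h1 := (d_path _ _ _ _ _ n u₁ v₁ w₁).symm.trans h1
  replace h2 := Eq.trans h2 (bd_path _ _ _ _ _ n u₂ v₂ w₂)
  have hu1 : U₁.d n u₁ = 0 := congrArg Prod.fst h1
  have hv1 := (castV_inj _ _ _).1 (congrArg (fun p => p.2.1) h1)
  have hw1 : W₁.d n w₁ = 0 := congrArg (fun p => p.2.2) h1
  have hu2 : tU.f n u₁ = U₂.bd n u₂ := congrArg Prod.fst h2
  have hv2 : tV.f (n + 1) v₁ = f₂.f (n + 1) u₂ + g₂.f (n + 1) w₂ - V₂.bd (n + 1) v₂ :=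
    congrArg (fun p => p.2.1) h2
  have hw2 : tW.f n w₁ = W₂.bd n w₂ := congrArg (fun p => p.2.2) h2
  obtain ⟨a, a', ha, ha'⟩ := htU.coneExact n u₁ u₂ hu1 hu2
  obtain ⟨c, c', hc, hc'⟩ := htW.coneExact n w₁ w₂ hw1 hw2
  obtain ⟨b, b', hb, hb'⟩ := htV.coneExact (n + 1)
    (f₁.f (n + 1) a + g₁.f (n + 1) c - v₁)
    (f₂.f (n + 1 + 1) a' + g₂.f (n + 1 + 1) c' + v₂) (by
      rw [← bd_eq_zero, map_sub, map_add, ← f₁.bd_comm, ← g₁.bd_comm, ha, hc]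
      exact hv1) (by
      rw [map_sub, map_add, hf, hg, ha', hc', hv2]
      simp only [map_add, f₂.bd_comm, g₂.bd_comm]
      abel)
  refine ⟨((a, b, c) : pathV _ _ _ (n + 1)), ((a', -b', c') : pathV _ _ _ (n + 1 + 1)), ?_, ?_⟩
  · refine (bd_path _ _ _ _ _ n a b c).trans ?_
    refine Prod.ext ha (Prod.ext ?_ hc)
    show _ - V₁.bd (n + 1) b = v₁
    rw [hb]; abel
  · refine Eq.trans ?_ (congrArg (fun z : pathV _ _ _ (n + 1) =>
      ((u₂, v₂, w₂) : pathV _ _ _ (n + 1)) + z)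
      (bd_path _ _ _ _ _ (n + 1) a' (-b') c').symm)
    refine Prod.ext ha' (Prod.ext ?_ hc')
    show tV.f (n + 1 + 1) b = v₂ + (_ - V₂.bd (n + 1 + 1) (-b'))
    rw [hb', map_neg]; abel
end

section
/- Consider a ladder of cospans of chain complexes of ℚ-vector spaces: for each i ≥ 1, chain maps t_i : U_i → V_i and r_i : W_i → V_i, together with chain maps h_i : U_i → U_{i+1}, g_i : V_i → V_{i+1}, f_i : W_i → W_{i+1} satisfying g_i ∘ t_i = t_{i+1} ∘ h_i and g_i ∘ r_i = r_{i+1} ∘ f_i. Then: (1) each mapping telescope Tel(U,h), Tel(V,g), Tel(W,f) is a chain complex (its differential squares to zero); (2) the induced maps Tel(t) : Tel(U,h) → Tel(V,g) and Tel(r) : Tel(W,f) → Tel(V,g) are chain maps; and (3) the mapping telescope of the path complexes, Tel(𝒫(t_i, r_i)) (formed using the chain maps 𝒫(t_i,r_i) → 𝒫(t_{i+1},r_{i+1}) induced by h_i, g_i, f_i), is isomorphic as a chain complex to the path complex 𝒫(Tel(t), Tel(r)). (Sequential homotopy colimits commute with homotopy pullbacks of rational chain complexes.) -/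
set_option autoImplicit false

namespace PreDG

/-- The `n`-th term of the mapping telescope of a sequence of chain maps
`γ_i : A_i → A_{i+1}`: `(⊕_i (A_i)_n) ⊕ (⊕_i (A_i)_{n-1})`. -/
abbrev telV (A : ℕ → PreDG) (n : ℤ) : Type :=
  (DirectSum ℕ fun i => (A i).V n) × (DirectSum ℕ fun i => (A i).V (n - 1))

/-- The telescope differential: on the unshifted summand `A_i` it is `x ↦ d x`, and on
the shifted summand `sA_i` it is `s x ↦ -s (d x) + x + γ_i x`. -/
def telD (A : ℕ → PreDG) (γ : ∀ (i : ℕ) (n : ℤ), (A i).V n →ₗ[ℚ] (A (i + 1)).V n)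
    (n : ℤ) : telV A n →ₗ[ℚ] telV A (n - 1) :=
  LinearMap.prod
    ((DirectSum.toModule ℚ ℕ _ (fun i =>
        (DirectSum.lof ℚ ℕ (fun j => (A j).V (n - 1)) i).comp ((A i).d n))).comp
      (LinearMap.fst ℚ (DirectSum ℕ fun i => (A i).V n)
        (DirectSum ℕ fun i => (A i).V (n - 1)))
     +
     (DirectSum.toModule ℚ ℕ _ (fun i =>
        DirectSum.lof ℚ ℕ (fun j => (A j).V (n - 1)) i
          + (DirectSum.lof ℚ ℕ (fun j => (A j).V (n - 1)) (i + 1)).comp (γ i (n - 1)))).comp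
      (LinearMap.snd ℚ (DirectSum ℕ fun i => (A i).V n)
        (DirectSum ℕ fun i => (A i).V (n - 1))))
    ((DirectSum.toModule ℚ ℕ _ (fun i =>
        (DirectSum.lof ℚ ℕ (fun j => (A j).V (n - 1 - 1)) i).comp (-((A i).d (n - 1))))).comp
      (LinearMap.snd ℚ (DirectSum ℕ fun i => (A i).V n)
        (DirectSum ℕ fun i => (A i).V (n - 1))))

/-- The telescope differential on an unshifted summand: `x ↦ d x`. -/
theorem telD_apply_of (A : ℕ → PreDG)
    (γ : ∀ (i : ℕ) (n : ℤ), (A i).V n →ₗ[ℚ] (A (i + 1)).V n) (n : ℤ) (i : ℕ)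
    (x : (A i).V n) :
    telD A γ n (DirectSum.lof ℚ ℕ (fun j => (A j).V n) i x, 0)
      = (DirectSum.lof ℚ ℕ (fun j => (A j).V (n - 1)) i ((A i).d n x), 0) := by
  simp [telD]

/-- The telescope differential on a shifted summand: `s x ↦ -s (d x) + x + γ_i x`. -/
theorem telD_apply_shift (A : ℕ → PreDG)
    (γ : ∀ (i : ℕ) (n : ℤ), (A i).V n →ₗ[ℚ] (A (i + 1)).V n) (n : ℤ) (i : ℕ)
    (x : (A i).V (n - 1)) :
    telD A γ n (0, DirectSum.lof ℚ ℕ (fun j => (A j).V (n - 1)) i x)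
      = (DirectSum.lof ℚ ℕ (fun j => (A j).V (n - 1)) i x
          + DirectSum.lof ℚ ℕ (fun j => (A j).V (n - 1)) (i + 1) (γ i (n - 1) x),
         DirectSum.lof ℚ ℕ (fun j => (A j).V (n - 1 - 1)) i (-((A i).d (n - 1) x))) := by
  simp [telD]

/-- The mapping telescope, as a graded vector space with degree `-1` map. -/
def telPre (A : ℕ → PreDG)
    (γ : ∀ (i : ℕ) (n : ℤ), (A i).V n →ₗ[ℚ] (A (i + 1)).V n) : PreDG where
  V := telV A
  grp := fun _ => inferInstance
  mod := fun _ => inferInstance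
  d := telD A γ

/-- The map of telescopes induced by a levelwise family of chain maps, acting by `φ_i` on
the unshifted summands and by the shift of `φ_i` on the shifted summands. -/
def telMap (A B : ℕ → PreDG)
    (φ : ∀ (i : ℕ) (n : ℤ), (A i).V n →ₗ[ℚ] (B i).V n) (n : ℤ) :
    telV A n →ₗ[ℚ] telV B n :=
  LinearMap.prodMap
    (DirectSum.toModule ℚ ℕ _ (fun i =>
      (DirectSum.lof ℚ ℕ (fun j => (B j).V n) i).comp (φ i n)))
    (DirectSum.toModule ℚ ℕ _ (fun i =>
      (DirectSum.lof ℚ ℕ (fun j => (B j).V (n - 1)) i).comp (φ i (n - 1))))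

end PreDG

open PreDG

namespace TelHelp

theorem tel_ext {A : ℕ → PreDG} {n : ℤ} {M : Type} [AddCommGroup M] [Module ℚ M]
    (φ ψ : telV A n →ₗ[ℚ] M)
    (h1 : ∀ i (x : (A i).V n), φ (DirectSum.lof ℚ ℕ (fun j => (A j).V n) i x, 0)
      = ψ (DirectSum.lof ℚ ℕ (fun j => (A j).V n) i x, 0))
    (h2 : ∀ i (x : (A i).V (n - 1)), φ (0, DirectSum.lof ℚ ℕ (fun j => (A j).V (n - 1)) i x)
      = ψ (0, DirectSum.lof ℚ ℕ (fun j => (A j).V (n - 1)) i x)) : φ = ψ := by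
  apply LinearMap.prod_ext
  · apply DirectSum.linearMap_ext
    intro i
    ext x
    exact h1 i x
  · apply DirectSum.linearMap_ext
    intro i
    ext x
    exact h2 i x

theorem pair_split {M N : Type} [AddCommGroup M] [AddCommGroup N] (a : M) (b : N) :
    (a, b) = (a, 0) + (0, b) := by simp

theorem pair_add {M N : Type} [AddCommGroup M] [AddCommGroup N] (a b : M) :
    ((a + b, 0) : M × N) = (a, 0) + (b, 0) := by simp

theorem tel_dd (A : ℕ → DG) (γ : ∀ i : ℕ, Hom (A i).toPreDG (A (i + 1)).toPreDG)
    (n : ℤ) (x : telV (fun i => (A i).toPreDG) n) :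
    telD (fun i => (A i).toPreDG) (fun i => (γ i).f) (n - 1)
      (telD (fun i => (A i).toPreDG) (fun i => (γ i).f) n x) = 0 := by
  have key : (telD (fun i => (A i).toPreDG) (fun i => (γ i).f) (n - 1)).comp
      (telD (fun i => (A i).toPreDG) (fun i => (γ i).f) n) = 0 := by
    apply tel_ext
    · intro i x
      simp [telD, (A i).dd]
    · intro i x
      simp [telD, (A i).dd, (γ i).comm]
  exact LinearMap.congr_fun key x

theorem tel_map_comm (A B : ℕ → DG) (γ : ∀ i : ℕ, Hom (A i).toPreDG (A (i + 1)).toPreDG)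
    (δ : ∀ i : ℕ, Hom (B i).toPreDG (B (i + 1)).toPreDG)
    (t : ∀ i : ℕ, Hom (A i).toPreDG (B i).toPreDG)
    (hlt : ∀ (i : ℕ) (n : ℤ) (x : (A i).V n),
        (δ i).f n ((t i).f n x) = (t (i + 1)).f n ((γ i).f n x))
    (n : ℤ) (x : telV (fun i => (A i).toPreDG) n) :
    telMap _ _ (fun i => (t i).f) (n - 1)
        (telD (fun i => (A i).toPreDG) (fun i => (γ i).f) n x)
      = telD (fun i => (B i).toPreDG) (fun i => (δ i).f) n
          (telMap _ _ (fun i => (t i).f) n x) := by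
  have key : (telMap _ _ (fun i => (t i).f) (n - 1)).comp
        (telD (fun i => (A i).toPreDG) (fun i => (γ i).f) n)
      = (telD (fun i => (B i).toPreDG) (fun i => (δ i).f) n).comp
          (telMap _ _ (fun i => (t i).f) n) := by
    apply tel_ext
    · intro i x
      simp [telD, telMap, (t i).comm]
    · intro i x
      simp [telD, telMap, (t i).comm, hlt]
  exact LinearMap.congr_fun key x

/-! Casts. -/

theorem cast_cast (A : PreDG) {m n k : ℤ} (h : m = n) (h' : n = k) (x : A.V m) :
    A.castV h' (A.castV h x) = A.castV (h.trans h') x := by subst h; subst h'; rfl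

theorem cast_self (A : PreDG) {m : ℤ} (h : m = m) (x : A.V m) : A.castV h x = x := rfl

theorem d_cast (A : PreDG) {m n : ℤ} (h : m = n) (x : A.V m) :
    A.d n (A.castV h x) = A.castV (by rw [h]) (A.d m x) := by subst h; rfl

theorem cast_tel (A : ℕ → PreDG)
    (γ : ∀ (i : ℕ) (n : ℤ), (A i).V n →ₗ[ℚ] (A (i + 1)).V n) {m n : ℤ} (h : m = n)
    (x : DirectSum ℕ fun i => (A i).V m) (y : DirectSum ℕ fun i => (A i).V (m - 1)) :
    (telPre A γ).castV h (x, y) =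
      (DirectSum.lmap (fun i => (A i).castV h) x,
       DirectSum.lmap (fun i => (A i).castV (show m - 1 = n - 1 by rw [h])) y) := by
  subst h
  have : ∀ k : ℤ, DirectSum.lmap (fun i => (A i).castV (rfl : k = k)) = LinearMap.id := by
    intro k
    apply DirectSum.linearMap_ext
    intro i
    ext x
    simp [DirectSum.lmap_lof, cast_self]
  rw [this, this]
  rfl

section equiv
variable (A B C : ℕ → PreDG) (t : ∀ (i : ℕ) (n : ℤ), (A i).V n →ₗ[ℚ] (B i).V n)
  (r : ∀ (i : ℕ) (n : ℤ), (C i).V n →ₗ[ℚ] (B i).V n)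

/-- target type, unfolded -/
abbrev tgt (n : ℤ) : Type := telV A n × telV B (n + 1) × telV C n

/-- forward map -/
noncomputable def fwd (n : ℤ) :
    telV (fun i => pathPre (A i) (B i) (C i) (t i) (r i)) n →ₗ[ℚ] tgt A B C n :=
  LinearMap.coprod
    (DirectSum.toModule ℚ ℕ _ (fun i =>
      (LinearMap.prodMap
        ((LinearMap.inl ℚ _ _).comp (DirectSum.lof ℚ ℕ (fun j => (A j).V n) i))
        (LinearMap.prodMap
          ((LinearMap.inl ℚ _ _).comp (DirectSum.lof ℚ ℕ (fun j => (B j).V (n + 1)) i))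
          ((LinearMap.inl ℚ _ _).comp (DirectSum.lof ℚ ℕ (fun j => (C j).V n) i))) :
        (A i).V n × (B i).V (n + 1) × (C i).V n →ₗ[ℚ] tgt A B C n)))
    (DirectSum.toModule ℚ ℕ _ (fun i =>
      (LinearMap.prodMap
        ((LinearMap.inr ℚ _ _).comp (DirectSum.lof ℚ ℕ (fun j => (A j).V (n - 1)) i))
        (LinearMap.prodMap
          (-(LinearMap.inr ℚ _ _).comp ((DirectSum.lof ℚ ℕ (fun j => (B j).V (n + 1 - 1)) i).comp
            ((B i).castV (show n - 1 + 1 = n + 1 - 1 by omega))))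
          ((LinearMap.inr ℚ _ _).comp (DirectSum.lof ℚ ℕ (fun j => (C j).V (n - 1)) i))) :
        (A i).V (n - 1) × (B i).V (n - 1 + 1) × (C i).V (n - 1) →ₗ[ℚ] tgt A B C n)))

/-- inclusion of a summand in the sum of path complexes -/
noncomputable def inc (n : ℤ) (i : ℕ) : (A i).V n × (B i).V (n + 1) × (C i).V n →ₗ[ℚ]
    DirectSum ℕ (fun i => (pathPre (A i) (B i) (C i) (t i) (r i)).V n) :=
  DirectSum.lof ℚ ℕ (fun i => (pathPre (A i) (B i) (C i) (t i) (r i)).V n) i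

theorem fwd_lof (n : ℤ) (i : ℕ) (u : (A i).V n) (v : (B i).V (n + 1)) (w : (C i).V n) :
    fwd A B C t r n (inc A B C t r n i (u, v, w), 0)
    = ((DirectSum.lof ℚ ℕ (fun j => (A j).V n) i u, 0),
       (DirectSum.lof ℚ ℕ (fun j => (B j).V (n + 1)) i v, 0),
       (DirectSum.lof ℚ ℕ (fun j => (C j).V n) i w, 0)) := by
  rw [fwd, LinearMap.coprod_apply, map_zero, add_zero]
  exact DirectSum.toModule_lof ..

theorem fwd_lof' (n : ℤ) (i : ℕ) (u : (A i).V (n - 1)) (v : (B i).V (n - 1 + 1))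
    (w : (C i).V (n - 1)) :
    fwd A B C t r n (0, inc A B C t r (n - 1) i (u, v, w))
    = ((0, DirectSum.lof ℚ ℕ (fun j => (A j).V (n - 1)) i u),
       (0, -DirectSum.lof ℚ ℕ (fun j => (B j).V (n + 1 - 1)) i
          ((B i).castV (show n - 1 + 1 = n + 1 - 1 by omega) v)),
       (0, DirectSum.lof ℚ ℕ (fun j => (C j).V (n - 1)) i w)) := by
  rw [fwd, LinearMap.coprod_apply, map_zero, zero_add]
  refine (DirectSum.toModule_lof ..).trans ?_
  refine Prod.ext rfl (Prod.ext (Prod.ext ?_ rfl) rfl)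
  exact neg_zero

/-- backward map -/
noncomputable def bwd (n : ℤ) :
    tgt A B C n →ₗ[ℚ] telV (fun i => pathPre (A i) (B i) (C i) (t i) (r i)) n :=
  LinearMap.coprod
    (LinearMap.prodMap
      (DirectSum.toModule ℚ ℕ _ (fun i => (inc A B C t r n i).comp (LinearMap.inl ℚ _ _)))
      (DirectSum.toModule ℚ ℕ _ (fun i => (inc A B C t r (n - 1) i).comp (LinearMap.inl ℚ _ _))))
    (LinearMap.coprod
      (LinearMap.prodMap
        (DirectSum.toModule ℚ ℕ _ (fun i => (inc A B C t r n i).comp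
          ((LinearMap.inr ℚ _ _).comp (LinearMap.inl ℚ _ _))))
        (DirectSum.toModule ℚ ℕ _ (fun i => (inc A B C t r (n - 1) i).comp
          ((LinearMap.inr ℚ _ _).comp ((LinearMap.inl ℚ _ _).comp
            (-((B i).castV (show n + 1 - 1 = n - 1 + 1 by omega))))))))
      (LinearMap.prodMap
        (DirectSum.toModule ℚ ℕ _ (fun i => (inc A B C t r n i).comp
          ((LinearMap.inr ℚ _ _).comp (LinearMap.inr ℚ _ _))))
        (DirectSum.toModule ℚ ℕ _ (fun i => (inc A B C t r (n - 1) i).comp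
          ((LinearMap.inr ℚ _ _).comp (LinearMap.inr ℚ _ _))))))

theorem bwd_lof (n : ℤ) (i : ℕ) (u : (A i).V n) (v : (B i).V (n + 1)) (w : (C i).V n) :
    bwd A B C t r n ((DirectSum.lof ℚ ℕ (fun j => (A j).V n) i u, 0),
       (DirectSum.lof ℚ ℕ (fun j => (B j).V (n + 1)) i v, 0),
       (DirectSum.lof ℚ ℕ (fun j => (C j).V n) i w, 0)) = (inc A B C t r n i (u, v, w), 0) := by
  simp only [bwd, LinearMap.coprod_apply, LinearMap.prodMap_apply, map_zero,
    DirectSum.toModule_lof, Prod.mk_add_mk, add_zero, LinearMap.comp_apply, ← map_add,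
    LinearMap.inl_apply, LinearMap.inr_apply, zero_add]

theorem bwd_lof' (n : ℤ) (i : ℕ) (u : (A i).V (n - 1)) (v : (B i).V (n + 1 - 1))
    (w : (C i).V (n - 1)) :
    bwd A B C t r n ((0, DirectSum.lof ℚ ℕ (fun j => (A j).V (n - 1)) i u),
       (0, DirectSum.lof ℚ ℕ (fun j => (B j).V (n + 1 - 1)) i v),
       (0, DirectSum.lof ℚ ℕ (fun j => (C j).V (n - 1)) i w)) =
    (0, inc A B C t r (n - 1) i
      (u, -(B i).castV (show n + 1 - 1 = n - 1 + 1 by omega) v, w)) := by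
  simp only [bwd, LinearMap.coprod_apply, LinearMap.prodMap_apply, map_zero,
    DirectSum.toModule_lof, Prod.mk_add_mk, add_zero, LinearMap.comp_apply, ← map_add,
    LinearMap.inl_apply, LinearMap.inr_apply, zero_add, LinearMap.neg_apply]

theorem path_ext {n : ℤ} {M : Type} [AddCommGroup M] [Module ℚ M]
    (φ ψ : telV (fun i => pathPre (A i) (B i) (C i) (t i) (r i)) n →ₗ[ℚ] M)
    (h1 : ∀ i u v w, φ (inc A B C t r n i (u, v, w), 0) = ψ (inc A B C t r n i (u, v, w), 0))
    (h2 : ∀ i u v w, φ (0, inc A B C t r (n - 1) i (u, v, w))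
      = ψ (0, inc A B C t r (n - 1) i (u, v, w))) : φ = ψ :=
  tel_ext φ ψ (fun i x => h1 i x.1 x.2.1 x.2.2) (fun i x => h2 i x.1 x.2.1 x.2.2)

theorem bwd_fwd (n : ℤ) : (bwd A B C t r n).comp (fwd A B C t r n) = LinearMap.id := by
  apply path_ext
  · intro i u v w
    rw [LinearMap.comp_apply, fwd_lof, bwd_lof]
    rfl
  · intro i u v w
    rw [LinearMap.comp_apply, fwd_lof', ← map_neg, bwd_lof', map_neg, neg_neg, cast_cast]
    rfl

theorem fb_lof (n : ℤ) (i : ℕ) (u : (A i).V n) (v : (B i).V (n + 1)) (w : (C i).V n) :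
    fwd A B C t r n (bwd A B C t r n ((DirectSum.lof ℚ ℕ (fun j => (A j).V n) i u, 0),
       (DirectSum.lof ℚ ℕ (fun j => (B j).V (n + 1)) i v, 0),
       (DirectSum.lof ℚ ℕ (fun j => (C j).V n) i w, 0))) =
      ((DirectSum.lof ℚ ℕ (fun j => (A j).V n) i u, 0),
       (DirectSum.lof ℚ ℕ (fun j => (B j).V (n + 1)) i v, 0),
       (DirectSum.lof ℚ ℕ (fun j => (C j).V n) i w, 0)) := by
  rw [bwd_lof, fwd_lof]

theorem fb_lof' (n : ℤ) (i : ℕ) (u : (A i).V (n - 1)) (v : (B i).V (n + 1 - 1))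
    (w : (C i).V (n - 1)) :
    fwd A B C t r n (bwd A B C t r n ((0, DirectSum.lof ℚ ℕ (fun j => (A j).V (n - 1)) i u),
       (0, DirectSum.lof ℚ ℕ (fun j => (B j).V (n + 1 - 1)) i v),
       (0, DirectSum.lof ℚ ℕ (fun j => (C j).V (n - 1)) i w))) =
      ((0, DirectSum.lof ℚ ℕ (fun j => (A j).V (n - 1)) i u),
       (0, DirectSum.lof ℚ ℕ (fun j => (B j).V (n + 1 - 1)) i v),
       (0, DirectSum.lof ℚ ℕ (fun j => (C j).V (n - 1)) i w)) := by
  rw [bwd_lof', fwd_lof', map_neg, map_neg, neg_neg, cast_cast, cast_self]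

theorem fwd_bwd (n : ℤ) : (fwd A B C t r n).comp (bwd A B C t r n) = LinearMap.id := by
  apply LinearMap.prod_ext
  · apply tel_ext
    · intro i u
      have := fb_lof A B C t r n i u 0 0
      simp only [map_zero] at this
      exact this
    · intro i u
      have := fb_lof' A B C t r n i u 0 0
      simp only [map_zero] at this
      exact this
  · apply LinearMap.prod_ext
    · apply tel_ext
      · intro i v
        have := fb_lof A B C t r n i 0 v 0
        simp only [map_zero] at this
        exact this
      · intro i v
        have := fb_lof' A B C t r n i 0 v 0
        simp only [map_zero] at this
        exact this
    · apply tel_ext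
      · intro i w
        have := fb_lof A B C t r n i 0 0 w
        simp only [map_zero] at this
        exact this
      · intro i w
        have := fb_lof' A B C t r n i 0 0 w
        simp only [map_zero] at this
        exact this

/-- The isomorphism in degree `n`. -/
noncomputable def equ (n : ℤ) :
    telV (fun i => pathPre (A i) (B i) (C i) (t i) (r i)) n ≃ₗ[ℚ] tgt A B C n :=
  LinearEquiv.ofLinearMap _ _ (fwd_bwd A B C t r n) (bwd_fwd A B C t r n)


variable (h : ∀ (i : ℕ) (n : ℤ), (A i).V n →ₗ[ℚ] (A (i + 1)).V n)
  (g : ∀ (i : ℕ) (n : ℤ), (B i).V n →ₗ[ℚ] (B (i + 1)).V n)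
  (f : ∀ (i : ℕ) (n : ℤ), (C i).V n →ₗ[ℚ] (C (i + 1)).V n)

theorem f_cast {X Y : PreDG} (φ : ∀ n : ℤ, X.V n →ₗ[ℚ] Y.V n) {m n : ℤ} (h : m = n) (x : X.V m) :
    φ n (X.castV h x) = Y.castV h (φ m x) := by subst h; rfl

theorem telMap_lof (t : ∀ (i : ℕ) (n : ℤ), (A i).V n →ₗ[ℚ] (B i).V n) (n : ℤ) (i : ℕ)
    (x : (A i).V n) :
    telMap A B t n (DirectSum.lof ℚ ℕ (fun j => (A j).V n) i x, 0)
      = (DirectSum.lof ℚ ℕ (fun j => (B j).V n) i (t i n x), 0) := by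
  simp [telMap]

theorem telMap_lof' (t : ∀ (i : ℕ) (n : ℤ), (A i).V n →ₗ[ℚ] (B i).V n) (n : ℤ) (i : ℕ)
    (x : (A i).V (n - 1)) :
    telMap A B t n (0, DirectSum.lof ℚ ℕ (fun j => (A j).V (n - 1)) i x)
      = (0, DirectSum.lof ℚ ℕ (fun j => (B j).V (n - 1)) i (t i (n - 1) x)) := by
  simp [telMap]

/-- telescope differential of the path complexes -/
noncomputable def TP (n : ℤ) : telV (fun i => pathPre (A i) (B i) (C i) (t i) (r i)) n →ₗ[ℚ]
    telV (fun i => pathPre (A i) (B i) (C i) (t i) (r i)) (n - 1) :=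
  telD (fun i => pathPre (A i) (B i) (C i) (t i) (r i))
    (fun i n => LinearMap.prodMap (h i n) (LinearMap.prodMap (g i (n + 1)) (f i n))) n

theorem TP_lof (n : ℤ) (i : ℕ) (u : (A i).V n) (v : (B i).V (n + 1)) (w : (C i).V n) :
    TP A B C t r h g f n (inc A B C t r n i (u, v, w), 0) =
    (inc A B C t r (n - 1) i ((A i).d n u,
      (B i).castV (show n = n - 1 + 1 by omega) (t i n u + r i n w)
           - (B i).castV (show n + 1 - 1 = n - 1 + 1 by omega) ((B i).d (n + 1) v),
      (C i).d n w), 0) :=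
  telD_apply_of (fun i => pathPre (A i) (B i) (C i) (t i) (r i)) _ n i _

theorem TP_lof' (n : ℤ) (i : ℕ) (u : (A i).V (n - 1)) (v : (B i).V (n - 1 + 1))
    (w : (C i).V (n - 1)) :
    TP A B C t r h g f n (0, inc A B C t r (n - 1) i (u, v, w)) =
    (inc A B C t r (n - 1) i (u, v, w)
      + inc A B C t r (n - 1) (i + 1) (h i (n - 1) u, g i (n - 1 + 1) v, f i (n - 1) w),
     inc A B C t r (n - 1 - 1) i (-((A i).d (n - 1) u),
      -((B i).castV (show n - 1 = n - 1 - 1 + 1 by omega) (t i (n - 1) u + r i (n - 1) w)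
        - (B i).castV (show n - 1 + 1 - 1 = n - 1 - 1 + 1 by omega) ((B i).d (n - 1 + 1) v)),
      -((C i).d (n - 1) w))) :=
  telD_apply_shift (fun i => pathPre (A i) (B i) (C i) (t i) (r i)) _ n i _

/-- cast on telescopes -/
noncomputable def castT {m n : ℤ} (e : m = n) : telV B m →ₗ[ℚ] telV B n :=
  (telPre B g).castV e

theorem castT_mk {m n : ℤ} (e : m = n)
    (x : DirectSum ℕ fun i => (B i).V m) (y : DirectSum ℕ fun i => (B i).V (m - 1)) :
    castT B g e (x, y) =
      (DirectSum.lmap (fun i => (B i).castV e) x,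
       DirectSum.lmap (fun i => (B i).castV (show m - 1 = n - 1 by rw [e])) y) :=
  cast_tel B g e x y

/-- differential of the path complex of telescopes -/
noncomputable def PT (n : ℤ) : tgt A B C n →ₗ[ℚ] tgt A B C (n - 1) :=
  pathD (telPre A h) (telPre B g) (telPre C f) (fun n => telMap A B t n)
        (fun n => telMap C B r n) n

theorem PT_apply (n : ℤ) (a : telV A n) (b : telV B (n + 1)) (c : telV C n) :
    PT A B C t r h g f n (a, b, c) = (telD A h n a,
      castT B g (show n = n - 1 + 1 by omega) (telMap A B t n a + telMap C B r n c)
      - castT B g (show n + 1 - 1 = n - 1 + 1 by omega) (telD B g (n + 1) b),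
      telD C f n c) := rfl

theorem fwd_comm (n : ℤ) :
    (fwd A B C t r (n - 1)).comp (TP A B C t r h g f n)
    = (PT A B C t r h g f n).comp (fwd A B C t r n) := by
  apply path_ext
  · intro i u v w
    rw [LinearMap.comp_apply, LinearMap.comp_apply, fwd_lof, TP_lof, fwd_lof, PT_apply]
    rw [telMap_lof, telMap_lof, telD_apply_of, telD_apply_of, telD_apply_of, Prod.mk_add_mk,
      ← map_add, castT_mk, castT_mk, DirectSum.lmap_lof, DirectSum.lmap_lof]
    simp
  · intro i u v w
    rw [LinearMap.comp_apply, LinearMap.comp_apply, fwd_lof', ← map_neg, TP_lof', PT_apply]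
    rw [pair_split, pair_add, map_add, map_add, fwd_lof, fwd_lof, fwd_lof', telMap_lof', telMap_lof', telD_apply_shift,
      telD_apply_shift, telD_apply_shift, Prod.mk_add_mk, castT_mk, castT_mk]
    simp only [map_add, map_sub, map_neg, map_zero, DirectSum.lmap_lof, cast_cast, d_cast,
      f_cast (g i), cast_self]
    simp only [Prod.mk_add_mk, Prod.mk_sub_mk, Prod.mk.injEq]
    simp
    try abel

end equiv
end TelHelp

/-- Sequential homotopy colimits (mapping telescopes) commute with
homotopy pullbacks (path complexes) of rational chain complexes.  Given a ladder of
cospans `t_i : U_i → V_i ← W_i : r_i` with ladder maps `h_i, g_i, f_i`: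
(1) the mapping telescopes `Tel(U,h)`, `Tel(V,g)`, `Tel(W,f)` are chain complexes;
(2) the induced maps `Tel(t) : Tel(U,h) → Tel(V,g)` and `Tel(r) : Tel(W,f) → Tel(V,g)`
are chain maps; and
(3) the telescope of the path complexes `Tel(𝒫(t_i, r_i))` is isomorphic as a chain
complex to the path complex `𝒫(Tel(t), Tel(r))`. -/
theorem telescope_commutes_with_path_complex
    (U V W : ℕ → DG)
    (t : ∀ i : ℕ, Hom (U i).toPreDG (V i).toPreDG)
    (r : ∀ i : ℕ, Hom (W i).toPreDG (V i).toPreDG)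
    (h : ∀ i : ℕ, Hom (U i).toPreDG (U (i + 1)).toPreDG)
    (g : ∀ i : ℕ, Hom (V i).toPreDG (V (i + 1)).toPreDG)
    (f : ∀ i : ℕ, Hom (W i).toPreDG (W (i + 1)).toPreDG)
    (hlt : ∀ (i : ℕ) (n : ℤ) (x : (U i).V n),
        (g i).f n ((t i).f n x) = (t (i + 1)).f n ((h i).f n x))
    (hlr : ∀ (i : ℕ) (n : ℤ) (x : (W i).V n),
        (g i).f n ((r i).f n x) = (r (i + 1)).f n ((f i).f n x)) :
    -- (1) the three telescopes are chain complexes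
    (∀ (n : ℤ) (x : telV (fun i => (U i).toPreDG) n),
        telD (fun i => (U i).toPreDG) (fun i => (h i).f) (n - 1)
          (telD (fun i => (U i).toPreDG) (fun i => (h i).f) n x) = 0) ∧
    (∀ (n : ℤ) (x : telV (fun i => (V i).toPreDG) n),
        telD (fun i => (V i).toPreDG) (fun i => (g i).f) (n - 1)
          (telD (fun i => (V i).toPreDG) (fun i => (g i).f) n x) = 0) ∧
    (∀ (n : ℤ) (x : telV (fun i => (W i).toPreDG) n),
        telD (fun i => (W i).toPreDG) (fun i => (f i).f) (n - 1)
          (telD (fun i => (W i).toPreDG) (fun i => (f i).f) n x) = 0) ∧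
    -- (2) the induced maps `Tel(t)` and `Tel(r)` are chain maps
    (∀ (n : ℤ) (x : telV (fun i => (U i).toPreDG) n),
        telMap _ _ (fun i => (t i).f) (n - 1)
            (telD (fun i => (U i).toPreDG) (fun i => (h i).f) n x)
          = telD (fun i => (V i).toPreDG) (fun i => (g i).f) n
              (telMap _ _ (fun i => (t i).f) n x)) ∧
    (∀ (n : ℤ) (x : telV (fun i => (W i).toPreDG) n),
        telMap _ _ (fun i => (r i).f) (n - 1)
            (telD (fun i => (W i).toPreDG) (fun i => (f i).f) n x)
          = telD (fun i => (V i).toPreDG) (fun i => (g i).f) n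
              (telMap _ _ (fun i => (r i).f) n x)) ∧
    -- (3) `Tel(𝒫(t_i, r_i)) ≅ 𝒫(Tel(t), Tel(r))` as chain complexes
    ∃ e : ∀ n : ℤ,
        telV (fun i => pathPre (U i).toPreDG (V i).toPreDG (W i).toPreDG (t i).f (r i).f) n
          ≃ₗ[ℚ]
        pathV (telPre (fun i => (U i).toPreDG) (fun i => (h i).f))
              (telPre (fun i => (V i).toPreDG) (fun i => (g i).f))
              (telPre (fun i => (W i).toPreDG) (fun i => (f i).f)) n,
      ∀ (n : ℤ)
        (x : telV (fun i => pathPre (U i).toPreDG (V i).toPreDG (W i).toPreDG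
                (t i).f (r i).f) n),
        e (n - 1)
            (telD (fun i => pathPre (U i).toPreDG (V i).toPreDG (W i).toPreDG
                (t i).f (r i).f)
              (fun i n => LinearMap.prodMap ((h i).f n)
                (LinearMap.prodMap ((g i).f (n + 1)) ((f i).f n))) n x)
          = pathD (telPre (fun i => (U i).toPreDG) (fun i => (h i).f))
              (telPre (fun i => (V i).toPreDG) (fun i => (g i).f))
              (telPre (fun i => (W i).toPreDG) (fun i => (f i).f))
              (fun n => telMap _ _ (fun i => (t i).f) n)
              (fun n => telMap _ _ (fun i => (r i).f) n) n (e n x) := by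
  refine ⟨TelHelp.tel_dd U h, TelHelp.tel_dd V g, TelHelp.tel_dd W f,
    TelHelp.tel_map_comm U V h g t hlt, TelHelp.tel_map_comm W V f g r hlr,
    fun n => TelHelp.equ (fun i => (U i).toPreDG) (fun i => (V i).toPreDG)
      (fun i => (W i).toPreDG) (fun i => (t i).f) (fun i => (r i).f) n, ?_⟩
  intro n x
  exact LinearMap.congr_fun (TelHelp.fwd_comm (fun i => (U i).toPreDG) (fun i => (V i).toPreDG)
      (fun i => (W i).toPreDG) (fun i => (t i).f) (fun i => (r i).f) (fun i => (h i).f)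
      (fun i => (g i).f) (fun i => (f i).f) n) x
end
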